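/- arXiv:2403.07791 — 3 statements merged into one kernel-verified Lean document; each statement's English description precedes it below -/
import Mathlib

section
/- Let Ω ⊆ ℝ² be open, let ū, v̄, φ : Ω → ℝ be smooth, let p : ℝ → ℝ be differentiable, and assume: ū > 0 on Ω; the divergence-free condition ∂_x ū + ∂_y v̄ = 0 on Ω; and the background momentum equation ū·∂_x ū + v̄·∂_y ū − ∂_y² ū = −p'(x) on Ω. Set u := ∂_y φ, v := −∂_x φ, Q := φ/ū and U := ∂_y Q. Then on Ω the linearized transport terms satisfy the good-unknown identity: ū·∂_x u + u·∂_x ū + v̄·∂_y u + v·∂_y ū = ū²·∂_x U + ū·v̄·∂_y U + (∂_y³ ū)·Q + 2·(∂_y² ū − p'(x))·U. -/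
noncomputable section

/-- Partial derivative in the first (horizontal) coordinate. -/
def pdx (f : ℝ × ℝ → ℝ) (p : ℝ × ℝ) : ℝ := deriv (fun t => f (t, p.2)) p.1

/-- Partial derivative in the second (vertical) coordinate. -/
def pdy (f : ℝ × ℝ → ℝ) (p : ℝ × ℝ) : ℝ := deriv (fun t => f (p.1, t)) p.2

theorem gu_slice_x {Ω : Set (ℝ × ℝ)} (hΩ : IsOpen Ω) {q : ℝ × ℝ} (hq : q ∈ Ω) :
    ∀ᶠ t in nhds q.1, (t, q.2) ∈ Ω :=
  (Continuous.prodMk_left q.2).continuousAt.eventually_mem (hΩ.mem_nhds hq)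

theorem gu_slice_y {Ω : Set (ℝ × ℝ)} (hΩ : IsOpen Ω) {q : ℝ × ℝ} (hq : q ∈ Ω) :
    ∀ᶠ t in nhds q.2, (q.1, t) ∈ Ω :=
  (Continuous.prodMk_right q.1).continuousAt.eventually_mem (hΩ.mem_nhds hq)

theorem gu_congr_x {Ω : Set (ℝ × ℝ)} (hΩ : IsOpen Ω) {f g : ℝ × ℝ → ℝ}
    (h : ∀ q ∈ Ω, f q = g q) : ∀ q ∈ Ω, pdx f q = pdx g q := by
  intro q hq
  apply Filter.EventuallyEq.deriv_eq
  filter_upwards [gu_slice_x hΩ hq] with t ht using h _ ht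

theorem gu_congr_y {Ω : Set (ℝ × ℝ)} (hΩ : IsOpen Ω) {f g : ℝ × ℝ → ℝ}
    (h : ∀ q ∈ Ω, f q = g q) : ∀ q ∈ Ω, pdy f q = pdy g q := by
  intro q hq
  apply Filter.EventuallyEq.deriv_eq
  filter_upwards [gu_slice_y hΩ hq] with t ht using h _ ht

theorem gu_diff {Ω : Set (ℝ × ℝ)} (hΩ : IsOpen Ω) {f : ℝ × ℝ → ℝ}
    (hf : ContDiffOn ℝ (⊤ : ℕ∞) f Ω) {q : ℝ × ℝ} (hq : q ∈ Ω) : DifferentiableAt ℝ f q :=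
  (hf.contDiffAt (hΩ.mem_nhds hq)).differentiableAt (by simp)

theorem gu_hx {Ω : Set (ℝ × ℝ)} (hΩ : IsOpen Ω) {f : ℝ × ℝ → ℝ}
    (hf : ContDiffOn ℝ (⊤ : ℕ∞) f Ω) {q : ℝ × ℝ} (hq : q ∈ Ω) :
    HasDerivAt (fun t => f (t, q.2)) (fderiv ℝ f q (1, 0)) q.1 := by
  have h1 : HasFDerivAt f (fderiv ℝ f q) (q.1, q.2) := (gu_diff hΩ hf hq).hasFDerivAt
  exact h1.comp_hasDerivAt q.1 ((hasDerivAt_id q.1).prodMk (hasDerivAt_const q.1 q.2))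

theorem gu_hy {Ω : Set (ℝ × ℝ)} (hΩ : IsOpen Ω) {f : ℝ × ℝ → ℝ}
    (hf : ContDiffOn ℝ (⊤ : ℕ∞) f Ω) {q : ℝ × ℝ} (hq : q ∈ Ω) :
    HasDerivAt (fun t => f (q.1, t)) (fderiv ℝ f q (0, 1)) q.2 := by
  have h1 : HasFDerivAt f (fderiv ℝ f q) (q.1, q.2) := (gu_diff hΩ hf hq).hasFDerivAt
  exact h1.comp_hasDerivAt q.2 ((hasDerivAt_const q.2 q.1).prodMk (hasDerivAt_id q.2))

theorem gu_x {Ω : Set (ℝ × ℝ)} (hΩ : IsOpen Ω) {f : ℝ × ℝ → ℝ}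
    (hf : ContDiffOn ℝ (⊤ : ℕ∞) f Ω) {q : ℝ × ℝ} (hq : q ∈ Ω) :
    HasDerivAt (fun t => f (t, q.2)) (pdx f q) q.1 :=
  (gu_hx hΩ hf hq).differentiableAt.hasDerivAt

theorem gu_y {Ω : Set (ℝ × ℝ)} (hΩ : IsOpen Ω) {f : ℝ × ℝ → ℝ}
    (hf : ContDiffOn ℝ (⊤ : ℕ∞) f Ω) {q : ℝ × ℝ} (hq : q ∈ Ω) :
    HasDerivAt (fun t => f (q.1, t)) (pdy f q) q.2 :=
  (gu_hy hΩ hf hq).differentiableAt.hasDerivAt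

theorem gu_fd {Ω : Set (ℝ × ℝ)} (hΩ : IsOpen Ω) {f : ℝ × ℝ → ℝ}
    (hf : ContDiffOn ℝ (⊤ : ℕ∞) f Ω) : ContDiffOn ℝ (⊤ : ℕ∞) (fderiv ℝ f) Ω :=
  hf.fderiv_of_isOpen hΩ (by simp)

theorem gu_smooth_x {Ω : Set (ℝ × ℝ)} (hΩ : IsOpen Ω) {f : ℝ × ℝ → ℝ}
    (hf : ContDiffOn ℝ (⊤ : ℕ∞) f Ω) : ContDiffOn ℝ (⊤ : ℕ∞) (pdx f) Ω :=
  ((gu_fd hΩ hf).clm_apply contDiffOn_const).congr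
    (fun _ hq => (gu_hx hΩ hf hq).deriv)

theorem gu_smooth_y {Ω : Set (ℝ × ℝ)} (hΩ : IsOpen Ω) {f : ℝ × ℝ → ℝ}
    (hf : ContDiffOn ℝ (⊤ : ℕ∞) f Ω) : ContDiffOn ℝ (⊤ : ℕ∞) (pdy f) Ω :=
  ((gu_fd hΩ hf).clm_apply contDiffOn_const).congr
    (fun _ hq => (gu_hy hΩ hf hq).deriv)

theorem gu_symm {Ω : Set (ℝ × ℝ)} (hΩ : IsOpen Ω) {f : ℝ × ℝ → ℝ}
    (hf : ContDiffOn ℝ (⊤ : ℕ∞) f Ω) {q : ℝ × ℝ} (hq : q ∈ Ω) :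
    pdx (pdy f) q = pdy (pdx f) q := by
  have hd : DifferentiableAt ℝ (fderiv ℝ f) q :=
    ((gu_fd hΩ hf).contDiffAt (hΩ.mem_nhds hq)).differentiableAt (by simp)
  have hs : IsSymmSndFDerivAt ℝ f q :=
    (hf.contDiffAt (hΩ.mem_nhds hq)).isSymmSndFDerivAt (by
      simp only [minSmoothness_of_isRCLikeNormedField]
      exact WithTop.coe_le_coe.2 (le_top : (2 : ℕ∞) ≤ ⊤))
  have e1 : pdx (pdy f) q = fderiv ℝ (fderiv ℝ f) q (1, 0) (0, 1) := by
    rw [gu_congr_x hΩ (f := pdy f) (g := fun r => fderiv ℝ f r (0, 1))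
      (fun r hr => (gu_hy hΩ hf hr).deriv) q hq]
    refine (gu_hx hΩ ((gu_fd hΩ hf).clm_apply contDiffOn_const) hq).deriv.trans ?_
    rw [fderiv_clm_apply hd (differentiableAt_const _)]
    simp
  have e2 : pdy (pdx f) q = fderiv ℝ (fderiv ℝ f) q (0, 1) (1, 0) := by
    rw [gu_congr_y hΩ (f := pdx f) (g := fun r => fderiv ℝ f r (1, 0))
      (fun r hr => (gu_hx hΩ hf hr).deriv) q hq]
    refine (gu_hy hΩ ((gu_fd hΩ hf).clm_apply contDiffOn_const) hq).deriv.trans ?_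
    rw [fderiv_clm_apply hd (differentiableAt_const _)]
    simp
  rw [e1, e2]
  exact hs _ _

/-- The good-unknown identity for the linearized Prandtl transport terms:
with `u = ∂_y φ`, `v = -∂_x φ`, `Q = φ/ū`, `U = ∂_y Q`, on an open set where the
background `[ū, v̄]` is smooth, positive, divergence-free and solves the
momentum equation `ū ∂_x ū + v̄ ∂_y ū - ∂_y² ū = -p'(x)`, one has
`ū ∂_x u + u ∂_x ū + v̄ ∂_y u + v ∂_y ū
  = ū² ∂_x U + ū v̄ ∂_y U + (∂_y³ ū) Q + 2(∂_y² ū - p'(x)) U`. -/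
theorem good_unknown_identity (Ω : Set (ℝ × ℝ)) (hΩ : IsOpen Ω)
    (ubar vbar φ : ℝ × ℝ → ℝ) (p : ℝ → ℝ)
    (hubar : ContDiffOn ℝ (⊤ : ℕ∞) ubar Ω) (hvbar : ContDiffOn ℝ (⊤ : ℕ∞) vbar Ω)
    (hφ : ContDiffOn ℝ (⊤ : ℕ∞) φ Ω) (hp : Differentiable ℝ p)
    (hpos : ∀ q ∈ Ω, 0 < ubar q)
    (hdiv : ∀ q ∈ Ω, pdx ubar q + pdy vbar q = 0)
    (hmom : ∀ q ∈ Ω,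
      ubar q * pdx ubar q + vbar q * pdy ubar q - pdy (pdy ubar) q = - deriv p q.1) :
    ∀ q ∈ Ω,
      ubar q * pdx (pdy φ) q + pdy φ q * pdx ubar q
        + vbar q * pdy (pdy φ) q + (- pdx φ q) * pdy ubar q
      = (ubar q) ^ 2 * pdx (pdy (fun r => φ r / ubar r)) q
        + ubar q * vbar q * pdy (pdy (fun r => φ r / ubar r)) q
        + pdy (pdy (pdy ubar)) q * (φ q / ubar q)
        + 2 * (pdy (pdy ubar) q - deriv p q.1) * pdy (fun r => φ r / ubar r) q := by
  intro q hq
  have sQ : ContDiffOn ℝ (⊤ : ℕ∞) (fun r => φ r / ubar r) Ω :=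
    hφ.div hubar (fun r hr => (hpos r hr).ne')
  obtain ⟨Q, hQ⟩ : ∃ Q : ℝ × ℝ → ℝ, Q = fun r => φ r / ubar r := ⟨_, rfl⟩
  have hφQ : ∀ r ∈ Ω, φ r = ubar r * Q r := fun r hr => by
    have := (hpos r hr).ne'
    rw [hQ]
    field_simp
  have hQq : φ q / ubar q = Q q := by rw [hQ]
  rw [hQq]
  rw [← hQ] at sQ ⊢
  have su := gu_smooth_y hΩ hubar
  have sU := gu_smooth_y hΩ sQ
  have φx : ∀ r ∈ Ω, pdx φ r = pdx ubar r * Q r + ubar r * pdx Q r := fun r hr => by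
    rw [gu_congr_x hΩ hφQ r hr]
    exact ((gu_x hΩ hubar hr).mul (gu_x hΩ sQ hr)).deriv
  have φy : ∀ r ∈ Ω, pdy φ r = pdy ubar r * Q r + ubar r * pdy Q r := fun r hr => by
    rw [gu_congr_y hΩ hφQ r hr]
    exact ((gu_y hΩ hubar hr).mul (gu_y hΩ sQ hr)).deriv
  have φyx : pdx (pdy φ) q = (pdx (pdy ubar) q * Q q + pdy ubar q * pdx Q q)
      + (pdx ubar q * pdy Q q + ubar q * pdx (pdy Q) q) := by
    rw [gu_congr_x hΩ φy q hq]
    exact (((gu_x hΩ su hq).mul (gu_x hΩ sQ hq)).add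
      ((gu_x hΩ hubar hq).mul (gu_x hΩ sU hq))).deriv
  have φyy : pdy (pdy φ) q = (pdy (pdy ubar) q * Q q + pdy ubar q * pdy Q q)
      + (pdy ubar q * pdy Q q + ubar q * pdy (pdy Q) q) := by
    rw [gu_congr_y hΩ φy q hq]
    exact (((gu_y hΩ su hq).mul (gu_y hΩ sQ hq)).add
      ((gu_y hΩ hubar hq).mul (gu_y hΩ sU hq))).deriv
  have hm := gu_congr_y hΩ hmom q hq
  have hm1 : pdy (fun r => ubar r * pdx ubar r + vbar r * pdy ubar r - pdy (pdy ubar) r) q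
      = ((pdy ubar q * pdx ubar q + ubar q * pdy (pdx ubar) q)
        + (pdy vbar q * pdy ubar q + vbar q * pdy (pdy ubar) q)) - pdy (pdy (pdy ubar)) q :=
    ((((gu_y hΩ hubar hq).mul (gu_y hΩ (gu_smooth_x hΩ hubar) hq)).add
      ((gu_y hΩ hvbar hq).mul (gu_y hΩ su hq))).sub
      (gu_y hΩ (gu_smooth_y hΩ su) hq)).deriv
  have hm2 : pdy (fun r => - deriv p r.1) q = 0 := by
    simp [pdy]
  rw [hm1, hm2, ← gu_symm hΩ hubar hq] at hm
  rw [φyx, φyy, φy q hq, φx q hq]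
  linear_combination Q q * hm + 2 * pdy Q q * hmom q hq - Q q * pdy ubar q * hdiv q hq
end
end

section
/- Let m ≥ 0, x > 0, and let constants 0 < c₁ ≤ c₂ and 0 < c₀ ≤ C₀ be given. Let w : [0,∞) → ℝ satisfy c₁·x^m·min(η,1) ≤ w(y) ≤ c₂·x^m·min(η,1) for all y ≥ 0 (where η = y·x^{(m−1)/2}), and let q : [0,∞) → ℝ satisfy c₀·min(s,1) ≤ q(s) ≤ C₀·min(s,1) for all s ≥ 0. Let U : [0,∞) → ℝ be continuously differentiable, and set γ² := ∫₀^∞ w(y)²·U(y)² dy, A² := ∫₀^∞ w(y)²·U(y)²·y·q(η)·x^m dy and B² := ∫₀^∞ w(y)·U'(y)² dy; assume these three integrals are finite and A > 0. Then there is a constant κ > 0, depending only on c₀, C₀, c₁, c₂, such that the Nash-type inequality holds: B² ≥ κ·min( x^{−1/4 + 3m/4}·γ⁵/A³ , x^m·γ⁶/A⁴ ). -/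
open MeasureTheory

noncomputable def nashMu (b y : ℝ) : ℝ := min (y * b) 1

lemma nashMu_cont (b : ℝ) : Continuous (nashMu b) := by
  unfold nashMu; fun_prop

lemma nashMu_mono {b : ℝ} (hb : 0 < b) : Monotone (nashMu b) := by
  intro y z h
  unfold nashMu
  exact min_le_min (by nlinarith) le_rfl

lemma nashMu_nonneg {b y : ℝ} (hb : 0 < b) (hy : 0 ≤ y) : 0 ≤ nashMu b y :=
  le_min (by positivity) zero_le_one

lemma nashMu_pos {b y : ℝ} (hb : 0 < b) (hy : 0 < y) : 0 < nashMu b y :=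
  lt_min (by positivity) zero_lt_one

lemma nashMu_two {b y : ℝ} (hb : 0 < b) (hy : 0 ≤ y) : nashMu b (2 * y) ≤ 2 * nashMu b y := by
  unfold nashMu
  rcases le_total (y * b) 1 with h | h
  · rw [min_eq_left h]; refine (min_le_left _ _).trans (by linarith)
  · rw [min_eq_right h]; refine (min_le_right _ _).trans (by linarith)

noncomputable def nashM (b y : ℝ) : ℝ := ∫ s in (0 : ℝ)..y, nashMu b s ^ 2

lemma nashM_deriv (b y : ℝ) : HasDerivAt (nashM b) (nashMu b y ^ 2) y := by
  have hc : Continuous fun s => nashMu b s ^ 2 := (nashMu_cont b).pow 2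
  exact intervalIntegral.integral_hasDerivAt_right (hc.intervalIntegrable _ _)
    (hc.stronglyMeasurableAtFilter _ _) hc.continuousAt

lemma nashM_nonneg {b y : ℝ} (hy : 0 ≤ y) : 0 ≤ nashM b y :=
  intervalIntegral.integral_nonneg hy fun _ _ => sq_nonneg _

lemma nashM_le {b y : ℝ} (hb : 0 < b) (hy : 0 ≤ y) : nashM b y ≤ y * nashMu b y ^ 2 := by
  have hc : Continuous fun s => nashMu b s ^ 2 := (nashMu_cont b).pow 2
  have := intervalIntegral.integral_mono_on (μ := volume) (a := 0) (b := y) hy (hc.intervalIntegrable _ _)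
    (g := fun _ => nashMu b y ^ 2) (intervalIntegrable_const) (fun s hs => by
      exact pow_le_pow_left₀ (nashMu_nonneg hb hs.1) (nashMu_mono hb hs.2) 2)
  simpa [nashM] using this

lemma nash_pointwise {b R y : ℝ} (hb : 0 < b) (hR : 0 < R) (hy : 0 ≤ y) (hyR : y ≤ 2 * R)
    (u v : ℝ) :
    1 / 2 * (nashMu b y ^ 2 * u ^ 2) - 16 * R ^ 2 * nashMu b R * (nashMu b y * v ^ 2) ≤
      nashMu b y ^ 2 * u ^ 2 + nashM b y * (2 * u * v) := by
  have hμ := nashMu_nonneg hb hy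
  have hM := nashM_le hb hy
  have hM0 : 0 ≤ nashM b y := nashM_nonneg hy
  have hle : nashMu b y ≤ 2 * nashMu b R :=
    (nashMu_mono hb hyR).trans (nashMu_two hb hR.le)
  have hr := nashMu_pos hb hR
  set μ := nashMu b y
  set r := nashMu b R
  set M := nashM b y
  have h1 : M * |u * v| ≤ y * μ ^ 2 * |u * v| := mul_le_mul_of_nonneg_right hM (abs_nonneg _)
  have h2 : 0 ≤ (μ * |u| - 2 * (y * μ) * |v|) ^ 2 := sq_nonneg _
  have h3 : y ^ 2 * μ ^ 2 ≤ 4 * R ^ 2 * (2 * r * μ) := by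
    have : y ^ 2 ≤ 4 * R ^ 2 := by nlinarith
    have : μ ^ 2 ≤ 2 * r * μ := by nlinarith
    gcongr
  have h4 : y ^ 2 * μ ^ 2 * v ^ 2 ≤ 4 * R ^ 2 * (2 * r * μ) * v ^ 2 :=
    mul_le_mul_of_nonneg_right h3 (sq_nonneg _)
  have h5 : -(M * |u * v|) ≤ M * (u * v) := by
    have := mul_le_mul_of_nonneg_left (neg_abs_le (u * v)) hM0
    linarith
  have h6 : (μ * |u| - 2 * (y * μ) * |v|) ^ 2 =
      μ ^ 2 * u ^ 2 - 4 * (y * μ ^ 2 * |u * v|) + 4 * (y ^ 2 * μ ^ 2 * v ^ 2) := by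
    rw [abs_mul, ← sq_abs u, ← sq_abs v]; ring
  nlinarith

lemma nash_step {b R y : ℝ} (hb : 0 < b) (hR : 0 < R) (hy : 0 ≤ y) (hyR : y ≤ 2 * R)
    {U : ℝ → ℝ} (hU : ContDiff ℝ 1 U) :
    1 / 2 * (∫ s in (0 : ℝ)..y, nashMu b s ^ 2 * U s ^ 2) -
      16 * R ^ 2 * nashMu b R * (∫ s in (0 : ℝ)..y, nashMu b s * deriv U s ^ 2) ≤
      nashM b y * U y ^ 2 := by
  have hd : Differentiable ℝ U := hU.differentiable (by norm_num)
  have hUc := hU.continuous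
  have hDc : Continuous (deriv U) := hU.continuous_deriv (by norm_num)
  have hμ := nashMu_cont b
  have hMc : Continuous (nashM b) :=
    continuous_iff_continuousAt.2 fun y => (nashM_deriv b y).continuousAt
  have hF : ∀ s ∈ Set.uIcc 0 y, HasDerivAt (fun s => nashM b s * U s ^ 2)
      (nashMu b s ^ 2 * U s ^ 2 + nashM b s * (2 * U s * deriv U s)) s := by
    intro s _
    have := (nashM_deriv b s).mul ((hd s).hasDerivAt.pow 2)
    refine this.congr_deriv ?_
    simp
  have hFTC := intervalIntegral.integral_eq_sub_of_hasDerivAt hF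
    (Continuous.intervalIntegrable (by fun_prop) _ _)
  have h0 : nashM b 0 = 0 := by simp [nashM]
  rw [h0, zero_mul, sub_zero] at hFTC
  rw [← hFTC, ← intervalIntegral.integral_const_mul, ← intervalIntegral.integral_const_mul,
    ← intervalIntegral.integral_sub (Continuous.intervalIntegrable (by fun_prop) _ _)
    (Continuous.intervalIntegrable (by fun_prop) _ _)]
  refine intervalIntegral.integral_mono_on hy (Continuous.intervalIntegrable (by fun_prop) _ _)
    (Continuous.intervalIntegrable (by fun_prop) _ _) fun s hs => ?_
  exact nash_pointwise hb hR hs.1 (hs.2.trans hyR) _ _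

lemma nash_core {b R : ℝ} (hb : 0 < b) (hR : 0 < R) {U : ℝ → ℝ} (hU : ContDiff ℝ 1 U)
    (hG : IntegrableOn (fun y => nashMu b y ^ 2 * U y ^ 2) (Set.Ioi 0))
    (hH : IntegrableOn (fun y => nashMu b y ^ 2 * U y ^ 2 * (y * nashMu b y)) (Set.Ioi 0))
    (hK : IntegrableOn (fun y => nashMu b y * deriv U y ^ 2) (Set.Ioi 0)) :
    (∫ y in Set.Ioi (0 : ℝ), nashMu b y ^ 2 * U y ^ 2) * (R * nashMu b R) ≤
      5 * (∫ y in Set.Ioi (0 : ℝ), nashMu b y ^ 2 * U y ^ 2 * (y * nashMu b y)) +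
      32 * (R ^ 3 * nashMu b R ^ 2) * (∫ y in Set.Ioi (0 : ℝ), nashMu b y * deriv U y ^ 2) := by
  have hUc := hU.continuous
  have hDc : Continuous (deriv U) := hU.continuous_deriv (by norm_num)
  have hμ := nashMu_cont b
  have hr := nashMu_pos hb hR
  set K := ∫ y in Set.Ioi (0 : ℝ), nashMu b y * deriv U y ^ 2 with hKdef
  set g : ℝ → ℝ := fun y => nashMu b y ^ 2 * U y ^ 2 with hg
  have hgc : Continuous g := by fun_prop
  have hg0 : ∀ y, 0 ≤ g y := fun y => by positivity
  have hsub : Set.Ioi R ⊆ Set.Ioi (0 : ℝ) := Set.Ioi_subset_Ioi hR.le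
  set T := ∫ y in Set.Ioi R, g y with hT
  set I := ∫ y in (0 : ℝ)..R, g y with hI
  have hsplit : (∫ y in Set.Ioi (0 : ℝ), g y) = I + T := by
    rw [hI, hT, intervalIntegral.integral_of_le hR.le, ← Set.Ioc_union_Ioi_eq_Ioi hR.le]
    refine setIntegral_union (Set.Ioc_disjoint_Ioi le_rfl) measurableSet_Ioi
      (hG.mono_set Set.Ioc_subset_Ioi_self) (hG.mono_set hsub)
  -- tail bound
  have htail : T * (R * nashMu b R) ≤
      ∫ y in Set.Ioi (0 : ℝ), nashMu b y ^ 2 * U y ^ 2 * (y * nashMu b y) := by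
    calc T * (R * nashMu b R) = ∫ y in Set.Ioi R, g y * (R * nashMu b R) := by
          rw [hT, integral_mul_const]
      _ ≤ ∫ y in Set.Ioi R, nashMu b y ^ 2 * U y ^ 2 * (y * nashMu b y) := by
          refine setIntegral_mono_on ((hG.mono_set hsub).mul_const _) (hH.mono_set hsub)
            measurableSet_Ioi fun y hy => ?_
          have hy' : R ≤ y := le_of_lt hy
          exact mul_le_mul_of_nonneg_left
            (mul_le_mul hy' (nashMu_mono hb hy') hr.le (hR.le.trans hy')) (hg0 y)
      _ ≤ _ := by
          refine setIntegral_mono_set hH ?_ hsub.eventuallyLE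
          refine (ae_restrict_iff' measurableSet_Ioi).2 (Filter.Eventually.of_forall fun y hy => ?_)
          have hy : 0 ≤ y := le_of_lt hy
          have := nashMu_nonneg hb hy
          simp only [Pi.zero_apply]
          positivity
  -- main bound
  have hpt : ∀ y ∈ Set.Icc R (2 * R), 1 / 2 * I - 16 * R ^ 2 * nashMu b R * K ≤ 2 * R * g y := by
    intro y hy
    have hy0 : 0 ≤ y := hR.le.trans hy.1
    have h1 := nash_step hb hR hy0 hy.2 hU
    have h2 : I ≤ ∫ s in (0 : ℝ)..y, g s :=
      intervalIntegral.integral_mono_interval le_rfl hR.le hy.1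
        (Filter.Eventually.of_forall hg0) (hgc.intervalIntegrable _ _)
    have h3 : (∫ s in (0 : ℝ)..y, nashMu b s * deriv U s ^ 2) ≤ K := by
      rw [intervalIntegral.integral_of_le hy0]
      refine setIntegral_mono_set hK ?_ (Set.Ioc_subset_Ioi_self).eventuallyLE
      refine (ae_restrict_iff' measurableSet_Ioi).2 (Filter.Eventually.of_forall fun y hy => ?_)
      exact mul_nonneg (nashMu_nonneg hb (le_of_lt hy)) (sq_nonneg _)
    have h4 : nashM b y * U y ^ 2 ≤ 2 * R * g y := by
      have h5 := nashM_le hb hy0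
      have h6 : y * nashMu b y ^ 2 ≤ 2 * R * nashMu b y ^ 2 :=
        mul_le_mul_of_nonneg_right hy.2 (sq_nonneg _)
      calc nashM b y * U y ^ 2 ≤ (2 * R * nashMu b y ^ 2) * U y ^ 2 :=
            mul_le_mul_of_nonneg_right (h5.trans h6) (sq_nonneg _)
        _ = _ := by rw [hg]; ring
    have h7 : 16 * R ^ 2 * nashMu b R * (∫ s in (0 : ℝ)..y, nashMu b s * deriv U s ^ 2) ≤
        16 * R ^ 2 * nashMu b R * K := mul_le_mul_of_nonneg_left h3 (by positivity)
    linarith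
  have hav := intervalIntegral.integral_mono_on (μ := volume) (a := R) (b := 2 * R) (by linarith)
    (intervalIntegrable_const) (Continuous.intervalIntegrable (by fun_prop) _ _) hpt
  rw [intervalIntegral.integral_const, intervalIntegral.integral_const_mul, smul_eq_mul] at hav
  have hT2 : (∫ y in R..(2 * R), g y) ≤ T := by
    rw [intervalIntegral.integral_of_le (by linarith)]
    exact setIntegral_mono_set (hG.mono_set hsub) (Filter.Eventually.of_forall hg0)
      (Set.Ioc_subset_Ioi_self).eventuallyLE
  have hI2 : I ≤ 4 * T + 32 * R ^ 2 * nashMu b R * K := by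
    have h1 : R * (1 / 2 * I - 16 * R ^ 2 * nashMu b R * K) ≤ R * (2 * T) := by
      have := mul_le_mul_of_nonneg_left hT2 (by linarith : 0 ≤ 2 * R)
      linarith
    have := le_of_mul_le_mul_left h1 hR
    linarith
  rw [hsplit]
  have : (I + T) * (R * nashMu b R) ≤
      (5 * T + 32 * R ^ 2 * nashMu b R * K) * (R * nashMu b R) :=
    mul_le_mul_of_nonneg_right (by linarith) (by positivity)
  nlinarith

lemma nash_final {P Q : ℝ} (hP : 0 < P) (hQ : 0 < Q) {a b s γ A B : ℝ} (ha : 0 < a) (hb : 0 < b)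
    (hs : 0 < s) (hsab : s ^ 2 = a * b) (hγ : 0 < γ) (hA : 0 < A)
    (h : ∀ R : ℝ, 0 < R → γ ^ 2 * (R * nashMu b R) * a ≤
      P * A ^ 2 + Q * a ^ 2 * (R ^ 3 * nashMu b R ^ 2) * B ^ 2) :
    min (1 / (8 * Q * P ^ 2)) (1 / (2 * Q * √(2 * P) ^ 3)) *
      min (s * γ ^ 5 / A ^ 3) (a * γ ^ 6 / A ^ 4) ≤ B ^ 2 := by
  have hm1 : 0 ≤ min (s * γ ^ 5 / A ^ 3) (a * γ ^ 6 / A ^ 4) := le_min (by positivity) (by positivity)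
  rcases le_total 1 (2 * P * A ^ 2 / (a * γ ^ 2) * b) with h1 | h1
  · calc _ ≤ 1 / (8 * Q * P ^ 2) * (a * γ ^ 6 / A ^ 4) :=
          mul_le_mul (min_le_left _ _) (min_le_right _ _) hm1 (by positivity)
      _ ≤ _ := by
        have h2 := h (2 * P * A ^ 2 / (a * γ ^ 2)) (by positivity)
        rw [nashMu, min_eq_right h1] at h2
        have e1 : γ ^ 2 * (2 * P * A ^ 2 / (a * γ ^ 2) * 1) * a = 2 * P * A ^ 2 := by
          field_simp
        have e2 : Q * a ^ 2 * ((2 * P * A ^ 2 / (a * γ ^ 2)) ^ 3 * 1 ^ 2) * B ^ 2 =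
          P * A ^ 2 * (8 * Q * P ^ 2 * A ^ 4 / (a * γ ^ 6) * B ^ 2) := by
          field_simp; ring
        rw [e1, e2] at h2
        have h3 : P * A ^ 2 * 1 ≤ P * A ^ 2 * (8 * Q * P ^ 2 * A ^ 4 / (a * γ ^ 6) * B ^ 2) := by
          linarith
        have h4 := le_of_mul_le_mul_left h3 (by positivity)
        calc _ = 1 / (8 * Q * P ^ 2) * (a * γ ^ 6 / A ^ 4) * 1 := by ring
          _ ≤ 1 / (8 * Q * P ^ 2) * (a * γ ^ 6 / A ^ 4) *
            (8 * Q * P ^ 2 * A ^ 4 / (a * γ ^ 6) * B ^ 2) :=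
              mul_le_mul_of_nonneg_left h4 (by positivity)
          _ = _ := by field_simp
  · have hp : 0 < √(2 * P) := Real.sqrt_pos.2 (by positivity)
    have hp2 : √(2 * P) ^ 2 = 2 * P := Real.sq_sqrt (by positivity)
    set p := √(2 * P)
    have hPp : P = p ^ 2 / 2 := by linarith
    have hbs : b = s ^ 2 / a := by rw [hsab]; field_simp
    calc _ ≤ 1 / (2 * Q * p ^ 3) * (s * γ ^ 5 / A ^ 3) :=
          mul_le_mul (min_le_right _ _) (min_le_left _ _) hm1 (by positivity)
      _ ≤ _ := by
        have h2 := h (p * A / (γ * s)) (by positivity)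
        have hle : p * A / (γ * s) * b ≤ 1 := by
          have : (p * A / (γ * s) * b) ^ 2 = 2 * P * A ^ 2 / (a * γ ^ 2) * b := by
            rw [hPp, hbs]; field_simp
          rw [← this] at h1
          exact (sq_le_one_iff₀ (by positivity)).1 h1
        rw [nashMu, min_eq_left hle] at h2
        have e1 : γ ^ 2 * (p * A / (γ * s) * (p * A / (γ * s) * b)) * a = p ^ 2 * A ^ 2 := by
          rw [hbs]; field_simp
        have e2 : Q * a ^ 2 * ((p * A / (γ * s)) ^ 3 * (p * A / (γ * s) * b) ^ 2) * B ^ 2 =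
          P * A ^ 2 * (2 * Q * p ^ 3 * A ^ 3 / (s * γ ^ 5) * B ^ 2) := by
          rw [hPp, hbs]; field_simp
        rw [e1, e2, hp2] at h2
        have h3 : P * A ^ 2 * 1 ≤ P * A ^ 2 * (2 * Q * p ^ 3 * A ^ 3 / (s * γ ^ 5) * B ^ 2) := by
          linarith
        have h4 := le_of_mul_le_mul_left h3 (by positivity)
        calc _ = 1 / (2 * Q * p ^ 3) * (s * γ ^ 5 / A ^ 3) * 1 := by ring
          _ ≤ 1 / (2 * Q * p ^ 3) * (s * γ ^ 5 / A ^ 3) *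
            (2 * Q * p ^ 3 * A ^ 3 / (s * γ ^ 5) * B ^ 2) :=
              mul_le_mul_of_nonneg_left h4 (by positivity)
          _ = _ := by field_simp

/-- If `c * f ≤ g` on `(0,∞)` with `f` continuous nonnegative and `g` integrable. -/
lemma nash_compare {f g : ℝ → ℝ} {c : ℝ} (hc : 0 < c) (hf : Continuous f)
    (hf0 : ∀ y, 0 < y → 0 ≤ f y) (hfg : ∀ y, 0 < y → c * f y ≤ g y)
    (hg : IntegrableOn g (Set.Ioi 0)) :
    IntegrableOn f (Set.Ioi 0) ∧
      c * (∫ y in Set.Ioi (0 : ℝ), f y) ≤ ∫ y in Set.Ioi (0 : ℝ), g y := by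
  have h1 : IntegrableOn f (Set.Ioi 0) := by
    refine Integrable.mono' (hg.const_mul c⁻¹) hf.aestronglyMeasurable ?_
    refine (ae_restrict_iff' measurableSet_Ioi).2 (Filter.Eventually.of_forall fun y hy => ?_)
    rw [Real.norm_of_nonneg (hf0 y hy), le_inv_mul_iff₀ hc]
    exact hfg y hy
  refine ⟨h1, ?_⟩
  rw [← integral_const_mul]
  exact setIntegral_mono_on (h1.const_mul c) hg measurableSet_Ioi hfg

/-- Nash-type inequality: with `w` comparable to the Falkner–Skan velocity
`x^m·min(η,1)` and `q` comparable to `min(·,1)`, setting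
`γ² = ∫ w² U²`, `A² = ∫ w² U² y q(η) x^m`, `B² = ∫ w (U')²`, one has
`B² ≥ κ·min( x^(-1/4+3m/4) γ⁵/A³ , x^m γ⁶/A⁴ )` with `κ` depending only on
the comparability constants. -/
theorem nash_type_inequality :
    ∀ c₀ C₀ c₁ c₂ : ℝ, 0 < c₀ → c₀ ≤ C₀ → 0 < c₁ → c₁ ≤ c₂ →
    ∃ κ : ℝ, 0 < κ ∧
      ∀ (m x : ℝ), 0 ≤ m → 0 < x →
      ∀ w : ℝ → ℝ,
        (∀ y : ℝ, 0 ≤ y →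
          c₁ * x ^ m * min (y * x ^ ((m - 1) / 2)) 1 ≤ w y ∧
          w y ≤ c₂ * x ^ m * min (y * x ^ ((m - 1) / 2)) 1) →
      ∀ q : ℝ → ℝ, (∀ s : ℝ, 0 ≤ s → c₀ * min s 1 ≤ q s ∧ q s ≤ C₀ * min s 1) →
      ∀ U : ℝ → ℝ, ContDiff ℝ 1 U →
      ∀ γ A B : ℝ, 0 ≤ γ → 0 ≤ A → 0 ≤ B →
        γ ^ 2 = (∫ y in Set.Ioi (0 : ℝ), (w y) ^ 2 * (U y) ^ 2) →
        A ^ 2 = (∫ y in Set.Ioi (0 : ℝ),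
            (w y) ^ 2 * (U y) ^ 2 * (y * q (y * x ^ ((m - 1) / 2)) * x ^ m)) →
        B ^ 2 = (∫ y in Set.Ioi (0 : ℝ), w y * (deriv U y) ^ 2) →
        IntegrableOn (fun y => (w y) ^ 2 * (U y) ^ 2) (Set.Ioi 0) →
        IntegrableOn (fun y =>
            (w y) ^ 2 * (U y) ^ 2 * (y * q (y * x ^ ((m - 1) / 2)) * x ^ m)) (Set.Ioi 0) →
        IntegrableOn (fun y => w y * (deriv U y) ^ 2) (Set.Ioi 0) →
        0 < A →
        B ^ 2 ≥ κ * min (x ^ ((-1 : ℝ) / 4 + 3 * m / 4) * γ ^ 5 / A ^ 3)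
            (x ^ m * γ ^ 6 / A ^ 4) := by
  intro c₀ C₀ c₁ c₂ hc₀ _ hc₁ hc₁₂
  have hc₂ : 0 < c₂ := hc₁.trans_le hc₁₂
  have hP : 0 < 5 * c₂ ^ 2 / (c₁ ^ 2 * c₀) := by positivity
  have hQ : 0 < 32 * c₂ ^ 2 / c₁ := by positivity
  set P := 5 * c₂ ^ 2 / (c₁ ^ 2 * c₀) with hPd
  set Q := 32 * c₂ ^ 2 / c₁ with hQd
  have hp : 0 < √(2 * P) := Real.sqrt_pos.2 (by positivity)
  refine ⟨min (1 / (8 * Q * P ^ 2)) (1 / (2 * Q * √(2 * P) ^ 3)),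
    lt_min (by positivity) (by positivity), ?_⟩
  intro m x _ hx w hw q hq U hU γ A B hγ _ _ hγi hAi hBi hGi hHi hKi hA
  rcases hγ.eq_or_lt with h0 | hγ
  · rw [← h0]
    simpa using sq_nonneg B
  have ha : 0 < x ^ m := Real.rpow_pos_of_pos hx _
  have hb : 0 < x ^ ((m - 1) / 2) := Real.rpow_pos_of_pos hx _
  have hs : 0 < x ^ ((-1 : ℝ) / 4 + 3 * m / 4) := Real.rpow_pos_of_pos hx _
  have hsab : (x ^ ((-1 : ℝ) / 4 + 3 * m / 4)) ^ 2 = x ^ m * x ^ ((m - 1) / 2) := by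
    rw [← Real.rpow_add hx, ← Real.rpow_natCast, ← Real.rpow_mul hx.le]
    congr 1; push_cast; ring
  refine nash_final hP hQ ha hb hs hsab hγ hA ?_
  intro R hR
  set a := x ^ m
  set b := x ^ ((m - 1) / 2)
  have hUc := hU.continuous
  have hDc : Continuous (deriv U) := hU.continuous_deriv (by norm_num)
  have hμ := nashMu_cont b
  have hw' : ∀ y : ℝ, 0 < y → c₁ * a * nashMu b y ≤ w y ∧ w y ≤ c₂ * a * nashMu b y :=
    fun y hy => hw y hy.le
  have hq' : ∀ y : ℝ, 0 < y → c₀ * nashMu b y ≤ q (y * b) :=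
    fun y hy => (hq (y * b) (by positivity)).1
  have hwsq : ∀ y : ℝ, 0 < y → (c₁ * a) ^ 2 * (nashMu b y ^ 2 * U y ^ 2) ≤ w y ^ 2 * U y ^ 2 := by
    intro y hy
    have h1 := nashMu_nonneg hb hy.le
    have h2 := pow_le_pow_left₀ (by positivity) (hw' y hy).1 2
    calc _ = (c₁ * a * nashMu b y) ^ 2 * U y ^ 2 := by ring
      _ ≤ _ := mul_le_mul_of_nonneg_right h2 (sq_nonneg _)
  obtain ⟨hG, -⟩ := nash_compare (f := fun y => nashMu b y ^ 2 * U y ^ 2)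
    (c := (c₁ * a) ^ 2) (by positivity) (by fun_prop) (fun y _ => by positivity) hwsq hGi
  obtain ⟨hH, hH2⟩ := nash_compare (f := fun y => nashMu b y ^ 2 * U y ^ 2 * (y * nashMu b y))
    (c := (c₁ * a) ^ 2 * (c₀ * a)) (by positivity) (by fun_prop)
    (fun y hy => by have := nashMu_nonneg hb hy.le; positivity) (fun y hy => by
      have h1 := nashMu_nonneg hb hy.le
      have h2 := hwsq y hy
      have h3 : y * (c₀ * nashMu b y) * a ≤ y * q (y * b) * a :=
        mul_le_mul_of_nonneg_right (mul_le_mul_of_nonneg_left (hq' y hy) hy.le) ha.le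
      calc _ = ((c₁ * a) ^ 2 * (nashMu b y ^ 2 * U y ^ 2)) * (y * (c₀ * nashMu b y) * a) := by ring
        _ ≤ _ := mul_le_mul h2 h3 (by positivity) (by positivity)) hHi
  obtain ⟨hK, hK2⟩ := nash_compare (f := fun y => nashMu b y * deriv U y ^ 2)
    (c := c₁ * a) (by positivity) (by fun_prop)
    (fun y hy => by have := nashMu_nonneg hb hy.le; positivity) (fun y hy => by
      calc _ = c₁ * a * nashMu b y * deriv U y ^ 2 := by ring
        _ ≤ _ := mul_le_mul_of_nonneg_right (hw' y hy).1 (sq_nonneg _)) hKi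
  have hG2 : γ ^ 2 ≤ (c₂ * a) ^ 2 * ∫ y in Set.Ioi (0 : ℝ), nashMu b y ^ 2 * U y ^ 2 := by
    rw [hγi, ← integral_const_mul]
    refine setIntegral_mono_on hGi (hG.const_mul _) measurableSet_Ioi fun y hy => ?_
    have h1 := nashMu_nonneg hb (le_of_lt hy)
    have h0 : 0 ≤ w y := le_trans (by positivity) (hw' y hy).1
    have h2 := pow_le_pow_left₀ h0 (hw' y hy).2 2
    calc _ ≤ (c₂ * a * nashMu b y) ^ 2 * U y ^ 2 := mul_le_mul_of_nonneg_right h2 (sq_nonneg _)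
      _ = _ := by ring
  have hcore := nash_core hb hR hU hG hH hK
  rw [← hAi] at hH2
  rw [← hBi] at hK2
  have hr := nashMu_pos hb hR
  set G := ∫ y in Set.Ioi (0 : ℝ), nashMu b y ^ 2 * U y ^ 2
  set H := ∫ y in Set.Ioi (0 : ℝ), nashMu b y ^ 2 * U y ^ 2 * (y * nashMu b y)
  set K := ∫ y in Set.Ioi (0 : ℝ), nashMu b y * deriv U y ^ 2
  set r := nashMu b R
  calc γ ^ 2 * (R * r) * a ≤ (c₂ * a) ^ 2 * G * (R * r) * a := by gcongr
    _ = c₂ ^ 2 * a ^ 3 * (G * (R * r)) := by ring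
    _ ≤ c₂ ^ 2 * a ^ 3 * (5 * H + 32 * (R ^ 3 * r ^ 2) * K) := by gcongr
    _ = P * ((c₁ * a) ^ 2 * (c₀ * a) * H) + Q * a ^ 2 * (R ^ 3 * r ^ 2) * (c₁ * a * K) := by
        rw [hPd, hQd]; field_simp
    _ ≤ _ := by gcongr
end

section
/- Let m ≥ 0 and c_* > 0. Suppose Γ : [1,∞) → [0,∞) is differentiable and satisfies the differential inequality (1/2)·Γ'(x) + c_*·min( x^{−1/4 + 3m/4}·Γ(x)^{5/2} , x^m·Γ(x)³ ) ≤ 0 for all x ≥ 1. Then there exists a constant C > 0, depending only on m, c_* and Γ(1), such that Γ(x) ≤ C·x^{−(1+m)/2} for all x ≥ 1. -/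
/-- ODE comparison lemma: a nonnegative differentiable `Γ` on `[1,∞)`
satisfying `(1/2)Γ' + c·min(x^(-1/4+3m/4) Γ^(5/2), x^m Γ³) ≤ 0` decays like
`Γ(x) ≤ C·x^(-(1+m)/2)`, with `C` depending only on `m`, `c` and `Γ(1)`. -/
theorem ode_decay_lemma (m c Γ₁ : ℝ) (hm : 0 ≤ m) (hc : 0 < c) :
    ∃ C : ℝ, 0 < C ∧
      ∀ Γ : ℝ → ℝ,
        (∀ x : ℝ, 1 ≤ x → 0 ≤ Γ x) →
        Γ 1 = Γ₁ →
        DifferentiableOn ℝ Γ (Set.Ici 1) →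
        (∀ x : ℝ, 1 ≤ x →
          (1 / 2) * derivWithin Γ (Set.Ici 1) x
            + c * min (x ^ ((-1 : ℝ) / 4 + 3 * m / 4) * Γ x ^ ((5 : ℝ) / 2))
                (x ^ m * Γ x ^ 3) ≤ 0) →
        ∀ x : ℝ, 1 ≤ x → Γ x ≤ C * x ^ (-(1 + m) / 2) := by
  have hq : 0 < (1 + m) / c := by positivity
  set C : ℝ := 1 + |Γ₁| + (1 + m) / c with hC
  have hC1 : 1 ≤ C := by have := abs_nonneg Γ₁; linarith
  have hC0 : 0 < C := by linarith
  have hCc : 1 + m ≤ c * C := by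
    have h1 : (1 + m) / c ≤ C := by have := abs_nonneg Γ₁; linarith
    rw [div_le_iff₀ hc] at h1
    linarith
  refine ⟨C, hC0, ?_⟩
  intro Γ hpos hΓ1 hd hineq x hx
  have hB : ∀ y : ℝ, 1 ≤ y → HasDerivAt (fun y : ℝ => C * y ^ (-(1 + m) / 2))
      (C * ((-(1 + m) / 2) * y ^ (-(1 + m) / 2 - 1))) y := by
    intro y hy
    exact (Real.hasDerivAt_rpow_const (Or.inl (by linarith))).const_mul C
  refine image_le_of_deriv_right_lt_deriv_boundary' (f := Γ)
    (f' := fun y => derivWithin Γ (Set.Ici 1) y) (a := 1) (b := x)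
    (B := fun y : ℝ => C * y ^ (-(1 + m) / 2))
    (B' := fun y : ℝ => C * ((-(1 + m) / 2) * y ^ (-(1 + m) / 2 - 1)))
    (hd.continuousOn.mono Set.Icc_subset_Ici_self) ?_ ?_ ?_ ?_ ?_ ⟨hx, le_refl x⟩
  · intro y hy
    exact ((hd y hy.1).hasDerivWithinAt).mono (Set.Ici_subset_Ici.2 hy.1)
  · have := le_abs_self Γ₁
    simp only [Real.one_rpow, mul_one]
    linarith
  · intro y hy
    exact (hB y hy.1).continuousAt.continuousWithinAt
  · intro y hy
    exact (hB y hy.1).hasDerivWithinAt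
  · intro y hy heq
    have hy1 : 1 ≤ y := hy.1
    have hy0 : 0 < y := by linarith
    have h := hineq y hy1
    have hP : 0 < y ^ (-(1 + m) / 2 - 1) := Real.rpow_pos_of_pos hy0 _
    have e1 : y ^ ((-1 : ℝ) / 4 + 3 * m / 4) * Γ y ^ ((5 : ℝ) / 2)
        = C ^ ((5 : ℝ) / 2) * y ^ (-(1 + m) / 2 - 1) := by
      rw [heq, Real.mul_rpow hC0.le (Real.rpow_nonneg hy0.le _), ← Real.rpow_mul hy0.le,
        mul_left_comm, ← Real.rpow_add hy0]
      congr 2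
      ring
    have e2 : y ^ m * Γ y ^ 3 = C ^ 3 * y ^ (-(1 + m) / 2 - 1) := by
      rw [heq, mul_pow, ← Real.rpow_natCast (y ^ (-(1 + m) / 2)), ← Real.rpow_mul hy0.le,
        mul_left_comm, ← Real.rpow_add hy0]
      congr 2
      push_cast
      ring
    have h52 : C ^ 2 ≤ C ^ ((5 : ℝ) / 2) := by
      rw [← Real.rpow_natCast]
      exact Real.rpow_le_rpow_of_exponent_le hC1 (by norm_num)
    have h3 : C ^ 2 ≤ C ^ 3 := pow_le_pow_right₀ hC1 (by norm_num)
    have hmin : C ^ 2 * y ^ (-(1 + m) / 2 - 1) ≤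
        min (y ^ ((-1 : ℝ) / 4 + 3 * m / 4) * Γ y ^ ((5 : ℝ) / 2)) (y ^ m * Γ y ^ 3) := by
      rw [e1, e2]
      exact le_min (mul_le_mul_of_nonneg_right h52 hP.le) (mul_le_mul_of_nonneg_right h3 hP.le)
    have h4 := mul_le_mul_of_nonneg_left hmin hc.le
    have hCP : 0 < C * y ^ (-(1 + m) / 2 - 1) := mul_pos hC0 hP
    have h5 := mul_le_mul_of_nonneg_right hCc hCP.le
    have h6 : 0 < (1 + m) * (C * y ^ (-(1 + m) / 2 - 1)) := by positivity
    show derivWithin Γ (Set.Ici 1) y < C * ((-(1 + m) / 2) * y ^ (-(1 + m) / 2 - 1))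
    generalize y ^ (-(1 + m) / 2 - 1) = P at *
    nlinarith
end
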